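/- Let (Θ,d) be a complete separable metric space, Π a Borel probability measure on Θ, and M = Π^⊗ℕ₀ the countable product measure on Θ^ℕ₀ (the law of an i.i.d. Π-sequence). Let e_m be the empirical distribution map and R_m(M,Π) = ∫_{Θ^ℕ₀} w(e_m(θ(0),…,θ(m−1)), Π) M(dθ_∞). Then R_m(M,Π) → 0 as m → ∞; that is, the non-random crude Monte Carlo procedure is consistent to Π. -/

import Mathlib

open MeasureTheory ProbabilityTheory Filter Topology Matrix ENNReal

/-- The class `BL₁(Θ)` of Borel measurable functions `f : Θ → ℝ` with
`|f s - f t| ≤ d(s,t)` for all `s, t`. -/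
def BLone (Θ : Type*) [MeasurableSpace Θ] [PseudoMetricSpace Θ] : Set (Θ → ℝ) :=
  {f | Measurable f ∧ ∀ s t : Θ, |f s - f t| ≤ dist s t}

/-- The bounded Lipschitz distance `w(μ,ν) = sup_{f ∈ BL₁} |∫ f dμ - ∫ f dν|`. -/
noncomputable def blDist {Θ : Type*} [MeasurableSpace Θ] [PseudoMetricSpace Θ]
    (μ ν : Measure Θ) : ℝ :=
  ⨆ f ∈ BLone Θ, |∫ x, f x ∂μ - ∫ x, f x ∂ν|

/-- The empirical distribution `e_m(θ(0),…,θ(m-1)) = (1/m) ∑_{i<m} δ_{θ(i)}`. -/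
noncomputable def emp {Θ : Type*} [MeasurableSpace Θ] (θ : ℕ → Θ) (m : ℕ) : Measure Θ :=
  (m : ℝ≥0∞)⁻¹ • ∑ i ∈ Finset.range m, Measure.dirac (θ i)

/-- The risk `R_m(M,Π) = ∫ w(e_m(θ(0),…,θ(m-1)), Π) M(dθ_∞)`. -/
noncomputable def risk {Θ : Type*} [MeasurableSpace Θ] [PseudoMetricSpace Θ]
    (M : Measure (ℕ → Θ)) (target : Measure Θ) (m : ℕ) : ℝ :=
  ∫ θ, blDist (emp θ m) target ∂M

/-- `M` is the countable product measure `Π^{⊗ℕ₀}`, i.e. the law of an i.i.d. sequence with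
marginal `target`, characterized through its finite dimensional cylinder probabilities. -/
def IsIID {Θ : Type*} [MeasurableSpace Θ] (M : Measure (ℕ → Θ)) (target : Measure Θ) : Prop :=
  ∀ (n : ℕ) (A : Fin n → Set Θ), (∀ i, MeasurableSet (A i)) →
    M {θ | ∀ i : Fin n, θ i ∈ A i} = ∏ i, target (A i)

theorem IsIID.eq_infinitePi {Θ : Type*} [MeasurableSpace Θ] {M : Measure (ℕ → Θ)}
    {pr : Measure Θ} [IsProbabilityMeasure pr] (hM : IsIID M pr) :
    M = Measure.infinitePi fun _ : ℕ => pr := by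
  classical
  refine Measure.eq_infinitePi _ fun s t ht => ?_
  obtain ⟨n, hn⟩ := s.exists_nat_subset_range
  have h := hM n (fun i => if (i : ℕ) ∈ s then t i else Set.univ) fun i => by
    split_ifs
    exacts [ht _, MeasurableSet.univ]
  have hset : {θ : ℕ → Θ | ∀ i : Fin n, θ i ∈ if (i : ℕ) ∈ s then t i else Set.univ} =
      Set.pi s t := by
    ext θ
    simp only [Set.mem_ofPred_eq, Set.mem_pi, Finset.mem_coe]
    refine ⟨fun H i hi => ?_, fun H i => ?_⟩
    · simpa [hi] using H ⟨i, Finset.mem_range.1 (hn hi)⟩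
    · split_ifs with hi
      exacts [H i hi, Set.mem_univ _]
  rw [← hset, h, Fin.prod_univ_eq_prod_range (fun i => pr (if i ∈ s then t i else Set.univ)) n]
  refine (Finset.prod_subset hn fun i _ hi => by simp [hi]).symm.trans
    (Finset.prod_congr rfl fun i hi => by simp [hi])

theorem isProbabilityMeasure_emp {Θ : Type*} [MeasurableSpace Θ] (θ : ℕ → Θ) {m : ℕ}
    (hm : m ≠ 0) : IsProbabilityMeasure (emp θ m) := by
  refine ⟨?_⟩
  simp [emp, ENNReal.inv_mul_cancel, hm]

theorem integral_emp {Θ : Type*} [MeasurableSpace Θ] (θ : ℕ → Θ) (m : ℕ) {h : Θ → ℝ}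
    (hh : Measurable h) :
    ∫ x, h x ∂(emp θ m) = (m : ℝ)⁻¹ * ∑ i ∈ Finset.range m, h (θ i) := by
  rw [emp, integral_smul_measure, integral_finsetSum_measure]
  · simp [integral_dirac' _ _ hh.stronglyMeasurable]
  · exact fun i _ => integrable_dirac' hh.stronglyMeasurable (by simp)

theorem integrable_emp {Θ : Type*} [MeasurableSpace Θ] (θ : ℕ → Θ) {m : ℕ} (hm : m ≠ 0)
    {h : Θ → ℝ} (hh : Measurable h) : Integrable h (emp θ m) := by
  refine Integrable.smul_measure ?_ (by simp [hm])
  exact integrable_finsetSum_measure.2 fun i _ =>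
    integrable_dirac' hh.stronglyMeasurable (by simp)

/-- The law of large numbers in `L¹`, in terms of the empirical measures. -/
theorem IsIID.tendsto_integral_abs_integral_emp_sub {Θ : Type*} [MeasurableSpace Θ]
    {M : Measure (ℕ → Θ)} {pr : Measure Θ} [IsProbabilityMeasure pr] (hM : IsIID M pr)
    {h : Θ → ℝ} (hh : Measurable h) (hint : Integrable h pr) :
    (∀ m, Integrable (fun θ => |∫ x, h x ∂(emp θ m) - ∫ x, h x ∂pr|) M) ∧
    Tendsto (fun m => ∫ θ, |∫ x, h x ∂(emp θ m) - ∫ x, h x ∂pr| ∂M) atTop (𝓝 0) := by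
  rw [hM.eq_infinitePi]
  have hmp (i : ℕ) := measurePreserving_eval_infinitePi (fun _ : ℕ => pr) i
  have hXi (i : ℕ) : Integrable (fun θ : ℕ → Θ => h (θ i)) (Measure.infinitePi fun _ => pr) :=
    (hmp i).integrable_comp_of_integrable hint
  have hX0 : ∫ θ : ℕ → Θ, h (θ 0) ∂(Measure.infinitePi fun _ => pr) = ∫ x, h x ∂pr := by
    have hmap := integral_map (hmp 0).measurable.aemeasurable
      (hh.aestronglyMeasurable (μ := (Measure.infinitePi fun _ : ℕ => pr).map (Function.eval 0)))
    rw [(hmp 0).map_eq] at hmap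
    exact hmap.symm
  have hIm (m : ℕ) : Integrable (fun θ : ℕ → Θ => ∫ x, h x ∂(emp θ m) - ∫ x, h x ∂pr)
      (Measure.infinitePi fun _ => pr) := by
    simp only [integral_emp _ _ hh]
    exact ((integrable_finsetSum _ fun i _ => hXi i).const_mul _).sub (integrable_const _)
  refine ⟨fun m => (hIm m).abs, ?_⟩
  have key := strong_law_Lp (μ := Measure.infinitePi fun _ : ℕ => pr) le_rfl ENNReal.one_ne_top
    (fun (i : ℕ) (θ : ℕ → Θ) => h (θ i)) (memLp_one_iff_integrable.2 (hXi 0))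
    (fun i j hij => (iIndepFun_infinitePi (P := fun _ : ℕ => pr) (X := fun _ => h)
      fun _ => hh).indepFun hij)
    (fun i => by
      have hid : IdentDistrib (Function.eval i) (Function.eval 0)
          (Measure.infinitePi fun _ : ℕ => pr) (Measure.infinitePi fun _ : ℕ => pr) :=
        ⟨(hmp i).measurable.aemeasurable, (hmp 0).measurable.aemeasurable,
          (hmp i).map_eq.trans (hmp 0).map_eq.symm⟩
      exact hid.comp hh)
  simp only [hX0, smul_eq_mul, ← integral_emp _ _ hh] at key
  rw [← ENNReal.tendsto_toReal_iff
    (fun n => (memLp_one_iff_integrable.2 (hIm n)).eLpNorm_ne_top) ENNReal.zero_ne_top] at key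
  refine key.congr fun n => ?_
  rw [toReal_eLpNorm (hIm n).aestronglyMeasurable,
    lpNorm_one_eq_integral_norm (hIm n).aestronglyMeasurable]
  rfl

theorem measurable_dist_simpleFunc {Θ : Type*} [PseudoMetricSpace Θ]
    [SecondCountableTopology Θ] [MeasurableSpace Θ] [OpensMeasurableSpace Θ]
    (φ : SimpleFunc Θ Θ) : Measurable fun x => dist x (φ x) :=
  measurable_id.dist φ.measurable

/-- A probability measure with a finite first moment is quantized by simple functions. -/
theorem exists_simpleFunc_integral_dist_lt {Θ : Type*} [PseudoMetricSpace Θ]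
    [SecondCountableTopology Θ] [MeasurableSpace Θ] [BorelSpace Θ]
    {pr : Measure Θ} {x₀ : Θ} (hx₀ : Integrable (fun x => dist x x₀) pr) {ε : ℝ} (hε : 0 < ε) :
    ∃ φ : SimpleFunc Θ Θ, Integrable (fun x => dist x (φ x)) pr ∧
      ∫ x, dist x (φ x) ∂pr < ε := by
  let φ (n : ℕ) := SimpleFunc.approxOn id measurable_id Set.univ x₀ (Set.mem_univ _) n
  have hle (n : ℕ) (x : Θ) : dist x (φ n x) ≤ dist x x₀ := by
    have := SimpleFunc.edist_approxOn_le measurable_id (Set.mem_univ x₀) x n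
    rw [edist_comm, edist_comm x₀, edist_dist, edist_dist,
      ENNReal.ofReal_le_ofReal_iff dist_nonneg] at this
    exact this
  have hlim : Tendsto (fun n => ∫ x, dist x (φ n x) ∂pr) atTop (𝓝 (∫ _, (0 : ℝ) ∂pr)) := by
    refine tendsto_integral_of_dominated_convergence _
      (fun n => (measurable_dist_simpleFunc (φ n)).aestronglyMeasurable) hx₀
      (fun n => ae_of_all _ fun x => by simpa using hle n x) (ae_of_all _ fun x => ?_)
    have := SimpleFunc.tendsto_approxOn measurable_id (Set.mem_univ x₀) (x := x) (by simp)
    simpa [φ] using (tendsto_const_nhds (x := x)).dist this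
  rw [integral_zero] at hlim
  obtain ⟨n, hn⟩ := (hlim.eventually_lt_const hε).exists
  refine ⟨φ n, hx₀.mono' (measurable_dist_simpleFunc (φ n)).aestronglyMeasurable
    (ae_of_all _ fun x => by simpa using hle n x), hn⟩

theorem integral_comp_simpleFunc_eq_sum {Θ : Type*} [MeasurableSpace Θ] (φ : SimpleFunc Θ Θ)
    (g : Θ → ℝ) (μ : Measure Θ) [IsFiniteMeasure μ] :
    ∫ x, g (φ x) ∂μ = ∑ y ∈ φ.range, g y * ∫ x, (φ ⁻¹' {y}).indicator 1 x ∂μ := by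
  classical
  have hpt (x : Θ) : g (φ x) = ∑ y ∈ φ.range, g y * (φ ⁻¹' {y}).indicator (1 : Θ → ℝ) x := by
    simp [Set.indicator_apply, Finset.sum_ite_eq]
  simp_rw [hpt]
  have hint (y : Θ) : Integrable ((φ ⁻¹' {y}).indicator (1 : Θ → ℝ)) μ :=
    (integrable_const (1 : ℝ)).indicator (φ.measurableSet_preimage {y})
  rw [integral_finsetSum _ fun y _ => (hint y).const_mul _]
  simp_rw [integral_const_mul]

/-- Quantization bound for the difference of the integrals of a `1`-Lipschitz function. -/
theorem abs_integral_sub_integral_le {Θ : Type*} [PseudoMetricSpace Θ] [MeasurableSpace Θ]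
    {μ ν : Measure Θ} [IsProbabilityMeasure μ] [IsProbabilityMeasure ν] (φ : SimpleFunc Θ Θ)
    (x₀ : Θ) (hμ : Integrable (fun x => dist x (φ x)) μ)
    (hν : Integrable (fun x => dist x (φ x)) ν) {f : Θ → ℝ} (hf : f ∈ BLone Θ)
    (hfμ : Integrable f μ) (hfν : Integrable f ν) :
    |∫ x, f x ∂μ - ∫ x, f x ∂ν| ≤ ∫ x, dist x (φ x) ∂μ + ∫ x, dist x (φ x) ∂ν +
      ∑ y ∈ φ.range, dist y x₀ *
        |∫ x, (φ ⁻¹' {y}).indicator 1 x ∂μ - ∫ x, (φ ⁻¹' {y}).indicator 1 x ∂ν| := by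
  have happrox (ρ : Measure Θ) [IsProbabilityMeasure ρ]
      (hρ : Integrable (fun x => dist x (φ x)) ρ) (hfρ : Integrable f ρ) :
      |∫ x, f x ∂ρ - f x₀ - ∫ x, (f (φ x) - f x₀) ∂ρ| ≤ ∫ x, dist x (φ x) ∂ρ := by
    have hφ : Integrable (fun x => f (φ x)) ρ := (φ.map f).integrable_of_isFiniteMeasure
    rw [integral_sub hφ (integrable_const _), integral_const, probReal_univ, one_smul,
      sub_sub_sub_cancel_right, ← integral_sub hfρ hφ]
    exact (abs_integral_le_integral_abs).trans
      (integral_mono (hfρ.sub hφ).abs hρ fun x => hf.2 _ _)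
  have hsum : |∫ x, (f (φ x) - f x₀) ∂μ - ∫ x, (f (φ x) - f x₀) ∂ν| ≤
      ∑ y ∈ φ.range, dist y x₀ *
        |∫ x, (φ ⁻¹' {y}).indicator 1 x ∂μ - ∫ x, (φ ⁻¹' {y}).indicator 1 x ∂ν| := by
    rw [integral_comp_simpleFunc_eq_sum φ (fun y => f y - f x₀) μ,
      integral_comp_simpleFunc_eq_sum φ (fun y => f y - f x₀) ν, ← Finset.sum_sub_distrib]
    refine (Finset.abs_sum_le_sum_abs _ _).trans (Finset.sum_le_sum fun y _ => ?_)
    rw [← mul_sub, abs_mul]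
    exact mul_le_mul_of_nonneg_right (hf.2 _ _) (abs_nonneg _)
  have h1 := abs_le.1 (happrox μ hμ hfμ)
  have h2 := abs_le.1 (happrox ν hν hfν)
  have h3 := abs_le.1 hsum
  exact abs_le.2 ⟨by linarith, by linarith⟩

theorem integrable_of_mem_BLone {Θ : Type*} [PseudoMetricSpace Θ] [MeasurableSpace Θ]
    {μ : Measure Θ} [IsFiniteMeasure μ] {x₀ : Θ} (hx₀ : Integrable (fun x => dist x x₀) μ)
    {f : Θ → ℝ} (hf : f ∈ BLone Θ) : Integrable f μ := by
  refine ((integrable_const |f x₀|).add hx₀).mono' hf.1.aestronglyMeasurable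
    (ae_of_all _ fun x => ?_)
  have h1 := abs_sub_abs_le_abs_sub (f x) (f x₀)
  have h2 := hf.2 x x₀
  simp only [Real.norm_eq_abs, Pi.add_apply]
  linarith

theorem blDist_nonneg {Θ : Type*} [MeasurableSpace Θ] [PseudoMetricSpace Θ] (μ ν : Measure Θ) :
    0 ≤ blDist μ ν :=
  Real.iSup_nonneg fun _ => Real.iSup_nonneg fun _ => abs_nonneg _

/-- Without a first moment the supremum defining `blDist` is unbounded: adding constants to
`dist · x₀` changes only one of the two integrals. -/
theorem blDist_emp_eq_zero {Θ : Type*} [PseudoMetricSpace Θ] [MeasurableSpace Θ]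
    [OpensMeasurableSpace Θ] {pr : Measure Θ} [IsFiniteMeasure pr] {x₀ : Θ}
    (hx₀ : ¬ Integrable (fun x => dist x x₀) pr) (θ : ℕ → Θ) {m : ℕ} (hm : m ≠ 0) :
    blDist (emp θ m) pr = 0 := by
  have := isProbabilityMeasure_emp θ hm
  refine Real.iSup_of_not_bddAbove ?_
  rintro ⟨B, hB⟩
  set c : ℝ := |B| + 1
  have hd : Measurable fun x : Θ => dist x x₀ := (continuous_id.dist continuous_const).measurable
  have hmem : (fun x => dist x x₀ + c) ∈ BLone Θ :=
    ⟨hd.add_const c, fun s t => by simpa using abs_dist_sub_le s t x₀⟩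
  have hle := hB ⟨fun x => dist x x₀ + c, rfl⟩
  have hni : ¬ Integrable (fun x => dist x x₀ + c) pr := fun h =>
    hx₀ ((h.sub (integrable_const c)).congr (ae_of_all _ fun x => by simp))
  have hge : c ≤ ∫ x, (dist x x₀ + c) ∂(emp θ m) := by
    rw [integral_add (integrable_emp θ hm hd) (integrable_const _)]
    simpa using integral_nonneg fun x => dist_nonneg
  simp only [hmem, ciSup_pos, integral_undef hni, sub_zero] at hle
  have h1 := le_abs_self (∫ x, (dist x x₀ + c) ∂(emp θ m))
  have h2 := le_abs_self B
  linarith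

/-- The non-random crude Monte Carlo procedure is consistent: if `M` is the
law of an i.i.d. sequence from the Borel probability measure `Π` on a complete separable
metric space `Θ`, then `R_m(M,Π) = ∫ w(e_m(θ), Π) M(dθ_∞) → 0` as `m → ∞`. -/
theorem crude_monte_carlo_consistent {Θ : Type*} [MetricSpace Θ] [CompleteSpace Θ]
    [TopologicalSpace.SeparableSpace Θ] [MeasurableSpace Θ] [BorelSpace Θ]
    (pr : Measure Θ) [IsProbabilityMeasure pr]
    (M : Measure (ℕ → Θ)) [IsProbabilityMeasure M] (hM : IsIID M pr) :
    Tendsto (fun m => risk M pr m) atTop (𝓝 0) := by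
  have : SecondCountableTopology Θ := UniformSpace.secondCountable_of_separable Θ
  obtain ⟨x₀⟩ : Nonempty Θ := nonempty_of_isProbabilityMeasure pr
  by_cases hx₀ : Integrable (fun x => dist x x₀) pr
  swap
  · refine tendsto_const_nhds.congr' ?_
    filter_upwards [eventually_ne_atTop 0] with m hm
    simp [risk, blDist_emp_eq_zero hx₀ _ hm]
  refine tendsto_order.2 ⟨fun a ha => Eventually.of_forall fun m =>
    ha.trans_le (integral_nonneg fun θ => blDist_nonneg _ _), fun ε hε => ?_⟩
  obtain ⟨φ, hφ, hφε⟩ := exists_simpleFunc_integral_dist_lt hx₀ (half_pos hε)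
  obtain ⟨hDint, hDlim⟩ :=
    hM.tendsto_integral_abs_integral_emp_sub (measurable_dist_simpleFunc φ) hφ
  have hA (y : Θ) := hM.tendsto_integral_abs_integral_emp_sub (h := (φ ⁻¹' {y}).indicator 1)
    (measurable_one.indicator (φ.measurableSet_preimage {y}))
    ((integrable_const (1 : ℝ)).indicator (φ.measurableSet_preimage {y}))
  let D (m : ℕ) (θ : ℕ → Θ) : ℝ :=
    |∫ x, dist x (φ x) ∂(emp θ m) - ∫ x, dist x (φ x) ∂pr|
  let A (y : Θ) (m : ℕ) (θ : ℕ → Θ) : ℝ := |∫ x, (φ ⁻¹' {y}).indicator 1 x ∂(emp θ m) -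
    ∫ x, (φ ⁻¹' {y}).indicator 1 x ∂pr|
  have hSint (m : ℕ) : Integrable (fun θ => ∑ y ∈ φ.range, dist y x₀ * A y m θ) M :=
    integrable_finsetSum _ fun y _ => ((hA y).1 m).const_mul _
  have hCD (m : ℕ) : Integrable (fun θ => 2 * ∫ x, dist x (φ x) ∂pr + D m θ) M :=
    (integrable_const _).add (hDint m)
  have hbound (m : ℕ) (hm : m ≠ 0) (θ : ℕ → Θ) : blDist (emp θ m) pr ≤
      2 * ∫ x, dist x (φ x) ∂pr + D m θ + ∑ y ∈ φ.range, dist y x₀ * A y m θ := by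
    have := isProbabilityMeasure_emp θ hm
    have h0 : 0 ≤ ∫ x, dist x (φ x) ∂pr := integral_nonneg fun x => dist_nonneg
    have hR : 0 ≤ 2 * ∫ x, dist x (φ x) ∂pr + D m θ + ∑ y ∈ φ.range, dist y x₀ * A y m θ := by
      have : 0 ≤ ∑ y ∈ φ.range, dist y x₀ * A y m θ :=
        Finset.sum_nonneg fun y _ => mul_nonneg dist_nonneg (abs_nonneg _)
      have : 0 ≤ D m θ := abs_nonneg _
      positivity
    refine Real.iSup_le (fun f => Real.iSup_le (fun hf => ?_) hR) hR
    have h1 := abs_integral_sub_integral_le φ x₀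
      (integrable_emp θ hm (measurable_dist_simpleFunc φ)) hφ hf (integrable_emp θ hm hf.1)
      (integrable_of_mem_BLone hx₀ hf)
    have h2 : _ ≤ D m θ := le_abs_self _
    linarith
  have hlim : Tendsto (fun m => 2 * ∫ x, dist x (φ x) ∂pr + ∫ θ, D m θ ∂M +
      ∑ y ∈ φ.range, dist y x₀ * ∫ θ, A y m θ ∂M) atTop
      (𝓝 (2 * ∫ x, dist x (φ x) ∂pr + 0 + ∑ y ∈ φ.range, dist y x₀ * 0)) :=
    (tendsto_const_nhds.add hDlim).add
      (tendsto_finsetSum _ fun y _ => (hA y).2.const_mul _)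
  have hlt : 2 * ∫ x, dist x (φ x) ∂pr + 0 + ∑ y ∈ φ.range, dist y x₀ * 0 < ε := by
    simp only [mul_zero, Finset.sum_const_zero, add_zero]
    linarith
  filter_upwards [hlim.eventually_lt_const hlt, eventually_ne_atTop 0] with m hm hm0
  refine lt_of_le_of_lt ?_ hm
  refine (integral_mono_of_nonneg (ae_of_all _ fun θ => blDist_nonneg _ _)
    ((hCD m).add (hSint m)) (ae_of_all _ (hbound m hm0))).trans_eq ?_
  simp only [Pi.add_apply]
  rw [integral_add (hCD m) (hSint m), integral_add (integrable_const _) (hDint m),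
    integral_finsetSum _ fun y _ => ((hA y).1 m).const_mul _]
  simp [integral_const_mul]
  rfl
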